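/- Let π ∈ 𝒜 be a simple permutation of length n ≥ 4 with π(2) ≠ 1, and let p = π⁻¹(1) be the position of its minimum. Then some entry strictly between position 1 and position p exceeds the first entry: there exists i with 1 < i < p and π(i) > π(1). -/

import Mathlib

/-- `σ` is contained in `π` as a pattern. -/
def Contains {k n : ℕ} (σ : Equiv.Perm (Fin k)) (π : Equiv.Perm (Fin n)) : Prop :=
  ∃ f : Fin k → Fin n, StrictMono f ∧ ∀ i j : Fin k, σ i < σ j ↔ π (f i) < π (f j)

/-- `π` avoids the pattern `σ`. -/
def Avoids {k n : ℕ} (σ : Equiv.Perm (Fin k)) (π : Equiv.Perm (Fin n)) : Prop :=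
  ¬ Contains σ π

/-- The permutation 4231 (0-indexed values). -/
noncomputable def p4231 : Equiv.Perm (Fin 4) := Equiv.ofBijective ![3,1,2,0] (by decide)

/-- The permutation 35142 (0-indexed values). -/
noncomputable def p35142 : Equiv.Perm (Fin 5) := Equiv.ofBijective ![2,4,0,3,1] (by decide)

/-- The permutation 42513 (0-indexed values). -/
noncomputable def p42513 : Equiv.Perm (Fin 5) := Equiv.ofBijective ![3,1,4,0,2] (by decide)

/-- The permutation 351624 (0-indexed values). -/
noncomputable def p351624 : Equiv.Perm (Fin 6) := Equiv.ofBijective ![2,4,0,5,1,3] (by decide)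

/-- Membership in the class 𝒜 = Av(4231, 35142, 42513, 351624). -/
def InA {n : ℕ} (π : Equiv.Perm (Fin n)) : Prop :=
  Avoids p4231 π ∧ Avoids p35142 π ∧ Avoids p42513 π ∧ Avoids p351624 π

/-- `s` is an interval of `π`: a set of consecutive positions whose image
under `π` is a set of consecutive values. -/
def IsPermInterval {n : ℕ} (π : Equiv.Perm (Fin n)) (s : Finset (Fin n)) : Prop :=
  (∀ a ∈ s, ∀ b ∈ s, ∀ j : Fin n, a ≤ j → j ≤ b → j ∈ s) ∧
  (∀ a ∈ s, ∀ b ∈ s, ∀ j : Fin n, π a ≤ π j → π j ≤ π b → j ∈ s)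

/-- `π` is simple: its only intervals are singletons (or empty) and the whole domain. -/
def IsSimple {n : ℕ} (π : Equiv.Perm (Fin n)) : Prop :=
  ∀ s : Finset (Fin n), IsPermInterval π s → s.card ≤ 1 ∨ s = Finset.univ

/-- The reverse complement of a permutation. -/
def revComp {n : ℕ} (π : Equiv.Perm (Fin n)) : Equiv.Perm (Fin n) :=
  (Fin.revPerm.trans π).trans Fin.revPerm

/-- The skew sum `σ ⊖ τ`. -/
def skewSum {m k : ℕ} (σ : Equiv.Perm (Fin m)) (τ : Equiv.Perm (Fin k)) :
    Equiv.Perm (Fin (m + k)) :=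
  finSumFinEquiv.symm.trans ((Equiv.sumCongr σ τ).trans
    ((Equiv.sumComm (Fin m) (Fin k)).trans (finSumFinEquiv.trans (finCongr (Nat.add_comm k m)))))

/-- The direct sum `α ⊕ β`. -/
def directSum {m k : ℕ} (α : Equiv.Perm (Fin m)) (β : Equiv.Perm (Fin k)) :
    Equiv.Perm (Fin (m + k)) :=
  finSumFinEquiv.symm.trans ((Equiv.sumCongr α β).trans finSumFinEquiv)

/-- The permutation 312 (0-indexed values). -/
noncomputable def p312 : Equiv.Perm (Fin 3) := Equiv.ofBijective ![2,0,1] (by decide)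

/-- The permutation 231 (0-indexed values). -/
noncomputable def p231 : Equiv.Perm (Fin 3) := Equiv.ofBijective ![1,2,0] (by decide)

/-- The number of simple permutations of length `n` in the class 𝒜. -/
noncomputable def simpleCount (n : ℕ) : ℕ :=
  Nat.card {π : Equiv.Perm (Fin n) // IsSimple π ∧ InA π}

/-- Four entries in the relative order 4231 form an occurrence of the pattern. -/
theorem contains_p4231 {n : ℕ} {π : Equiv.Perm (Fin n)} {a b c d : Fin n}
    (hab : a < b) (hbc : b < c) (hcd : c < d)
    (hdb : π d < π b) (hbc' : π b < π c) (hca : π c < π a) : Contains p4231 π := by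
  refine ⟨![a, b, c, d], ?_, ?_⟩
  · rw [Fin.strictMono_iff_lt_succ]
    intro i
    fin_cases i <;> simpa
  · intro i j
    fin_cases i <;> fin_cases j <;> simp [p4231] <;> order

/-- Five entries in the relative order 42513 form an occurrence of the pattern. -/
theorem contains_p42513 {n : ℕ} {π : Equiv.Perm (Fin n)} {a b c d e : Fin n}
    (hab : a < b) (hbc : b < c) (hcd : c < d) (hde : d < e)
    (hdb : π d < π b) (hbe : π b < π e) (hea : π e < π a) (hac : π a < π c) :
    Contains p42513 π := by
  refine ⟨![a, b, c, d, e], ?_, ?_⟩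
  · rw [Fin.strictMono_iff_lt_succ]
    intro i
    fin_cases i <;> simpa
  · intro i j
    fin_cases i <;> fin_cases j <;> simp [p42513] <;> order

/-- A simple permutation of length at least three does not start with its minimum. -/
theorem IsSimple.exists_lt_first {n : ℕ} (hn : 3 ≤ n) {π : Equiv.Perm (Fin n)}
    (hsimple : IsSimple π) {z : Fin n} (hz : ∀ j, z ≤ j) : ∃ j, π j < π z := by
  by_contra! hmin
  have hint : IsPermInterval π (Finset.univ.erase z) := by
    refine ⟨fun a ha b _ j haj _ => ?_, fun a ha b _ j haj _ => ?_⟩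
    · have := Finset.ne_of_mem_erase ha
      refine Finset.mem_erase.2 ⟨fun h => this ?_, Finset.mem_univ _⟩
      exact le_antisymm (h ▸ haj) (hz a)
    · have := Finset.ne_of_mem_erase ha
      refine Finset.mem_erase.2 ⟨fun h => this ?_, Finset.mem_univ _⟩
      exact π.injective (le_antisymm (h ▸ haj) (hmin a))
  rcases hsimple _ hint with h | h
  · rw [Finset.card_erase_of_mem (Finset.mem_univ z), Finset.card_univ, Fintype.card_fin] at h
    omega
  · exact Finset.notMem_erase z Finset.univ (by rw [h]; exact Finset.mem_univ z)

/-- In a simple permutation of length at least three, two entries in adjacent positions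
forming a descent are separated by the value of some other entry. -/
theorem IsSimple.exists_between_of_covBy {n : ℕ} (hn : 3 ≤ n) {π : Equiv.Perm (Fin n)}
    (hsimple : IsSimple π) {a b : Fin n} (hab : a ⋖ b) (hlt : π b < π a) :
    ∃ x, π b < π x ∧ π x < π a := by
  by_contra! hno
  have hint : IsPermInterval π {a, b} := by
    refine ⟨fun c hc d hd j hcj hjd => ?_, fun c hc d hd j hcj hjd => ?_⟩
    · have haj : a ≤ j := by
        have := hab.lt
        simp only [Finset.mem_insert, Finset.mem_singleton] at hc
        rcases hc with rfl | rfl <;> order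
      have hjb : j ≤ b := by
        have := hab.lt
        simp only [Finset.mem_insert, Finset.mem_singleton] at hd
        rcases hd with rfl | rfl <;> order
      rcases haj.eq_or_lt with h | h
      · simp [h]
      · simp [le_antisymm hjb (not_lt.1 (hab.2 h))]
    · have hbj : π b ≤ π j := by
        simp only [Finset.mem_insert, Finset.mem_singleton] at hc
        rcases hc with rfl | rfl <;> order
      have hja : π j ≤ π a := by
        simp only [Finset.mem_insert, Finset.mem_singleton] at hd
        rcases hd with rfl | rfl <;> order
      rcases hbj.eq_or_lt with h | h
      · simp [π.injective h]
      · simp [π.injective (le_antisymm hja (hno j h))]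
  rcases hsimple _ hint with h | h
  · rw [Finset.card_pair hab.lt.ne] at h
    omega
  · have := congrArg Finset.card h
    rw [Finset.card_pair hab.lt.ne, Finset.card_univ, Fintype.card_fin] at this
    omega

theorem statement_10 {n : ℕ} (hn : 4 ≤ n) (π : Equiv.Perm (Fin n))
    (hsimple : IsSimple π) (hA : InA π) (h2 : π ⟨1, by omega⟩ ≠ ⟨0, by omega⟩) :
    ∃ i : Fin n, (⟨0, by omega⟩ : Fin n) < i ∧ i < π⁻¹ ⟨0, by omega⟩ ∧
      π ⟨0, by omega⟩ < π i := by
  by_contra! hno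
  obtain ⟨h4231, -, h42513, -⟩ := hA
  have hmin : ∀ j : Fin n, (⟨0, by omega⟩ : Fin n) ≤ j := fun j => Nat.zero_le _
  have hcov : (⟨0, by omega⟩ : Fin n) ⋖ ⟨1, by omega⟩ := by
    refine ⟨Nat.zero_lt_one, fun c h h' => ?_⟩
    rw [Fin.lt_def] at h h'
    simp only at h h'
    omega
  obtain ⟨j₀, hj₀⟩ := hsimple.exists_lt_first (by omega) hmin
  obtain ⟨p, hp⟩ : ∃ p, p = π⁻¹ (⟨0, by omega⟩ : Fin n) := ⟨_, rfl⟩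
  have hp₀ : π p = ⟨0, by omega⟩ := by simp [hp]
  have hπp : ∀ j, π p ≤ π j := fun j => hp₀ ▸ hmin _
  have h1p : π (⟨1, by omega⟩ : Fin n) ≠ π p := by
    rwa [hp₀]
  rw [← hp] at hno
  generalize (⟨0, by omega⟩ : Fin n) = z at *
  generalize (⟨1, by omega⟩ : Fin n) = o at *
  have hzo : z < o := hcov.lt
  have ho : ∀ j, z < j → o ≤ j := fun j hj => not_lt.1 (hcov.2 hj)
  have hzp : z < p := lt_of_le_of_ne (hmin p) fun h => (hπp j₀).not_gt (h ▸ hj₀)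
  have hop : o < p := lt_of_le_of_ne (ho p hzp) fun h => h1p (h ▸ rfl)
  have hpo : π p < π o := lt_of_le_of_ne (hπp o) h1p.symm
  have hlt : ∀ j, z < j → j < p → π j < π z := fun j hj hjp =>
    lt_of_le_of_ne (hno j hj hjp) fun h => hj.ne' (π.injective h)
  have hprefix : ∀ j, z < j → j ≤ p → π j ≤ π o := by
    intro j hj hjp
    by_contra! h
    have hoj : o < j := lt_of_le_of_ne (ho j hj) (by rintro rfl; exact lt_irrefl _ h)
    have hjp' : j < p := lt_of_le_of_ne hjp (by rintro rfl; exact h.not_gt hpo)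
    exact h4231 (contains_p4231 hzo hoj hjp' hpo h (hlt j hj hjp'))
  have hoz : π o < π z := hlt o hzo hop
  have hlate : ∀ j, z < j → π o < π j → p < j := fun j hj h =>
    not_le.1 fun h' => (hprefix j hj h').not_gt h
  obtain ⟨x, hox, hxz⟩ := hsimple.exists_between_of_covBy (by omega) hcov hoz
  have hpx : p < x := hlate x
    (lt_of_le_of_ne (hmin x) (by rintro rfl; exact lt_irrefl _ hxz)) hox
  have hint : IsPermInterval π (Finset.univ.filter fun j => π j ≤ π o) := by
    simp only [IsPermInterval, Finset.mem_filter, Finset.mem_univ, true_and]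
    refine ⟨fun a ha b hb j haj hjb => ?_, fun a _ b hb j _ hjb => hjb.trans hb⟩
    by_contra! hj
    have hza : z < a := lt_of_le_of_ne (hmin a) (by rintro rfl; order)
    have hpj : p < j := hlate j (hza.trans_le haj) hj
    have hjb' : j < b := lt_of_le_of_ne hjb (by rintro rfl; order)
    have hbo : π b < π o := lt_of_le_of_ne hb fun h => by
      have := π.injective h
      order
    rcases lt_or_ge (π j) (π z) with hjz | hjz
    · exact h4231 (contains_p4231 hzo (hop.trans hpj) hjb' hbo hj hjz)
    · have hzj : π z < π j := lt_of_le_of_ne hjz fun h => by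
        have := π.injective h
        order
      rcases lt_trichotomy x b with hxb | rfl | hbx
      · exact h4231 (contains_p4231 hzo (hop.trans hpx) hxb hbo hox hxz)
      · order
      · exact h42513 (contains_p42513 hzo (hop.trans hpj) hjb' hbx hbo hox hxz hzj)
  rcases hsimple _ hint with h | h
  · exact hop.ne (Finset.card_le_one.1 h o (by simp) p (by simp [hpo.le]))
  · have := h ▸ Finset.mem_univ z
    simp only [Finset.mem_filter, Finset.mem_univ, true_and] at this
    order
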